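/- arXiv:2503.09558 — 3 statements merged into one kernel-verified Lean document; each statement's English description precedes it below -/
import Mathlib

section
/- Entries of D⁻¹𝕀L⁻¹𝕀ᵀ as Dodgson polynomials. Let G be a connected graph with positive Schwinger parameters. Then for all 1 ≤ i, j ≤ m, (D⁻¹ 𝕀 L⁻¹ 𝕀ᵀ)_{e_i, e_j} = δ_{ij} − (−1)^{i+j} a_j ψ^{e_i,e_j} / ψ_G, where δ_{ij} is the Kronecker delta. Moreover, for every i the diagonal entry satisfies (D⁻¹ 𝕀 L⁻¹ 𝕀ᵀ)_{e_i, e_i} = ψ_{G/e_i} / ψ_G, where ψ_{G/e_i} denotes det 𝕄 evaluated with a_i replaced by 0. -/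
open Matrix BigOperators

namespace GraphForms

/-- Vertices `x` and `y` are connected using only edges in `T` (in either direction). -/
def Conn (m n : ℕ) (s t : Fin m → Fin n) (T : Set (Fin m)) (x y : Fin n) : Prop :=
  Relation.ReflTransGen
    (fun a b => ∃ e ∈ T, (s e = a ∧ t e = b) ∨ (s e = b ∧ t e = a)) x y

/-- The graph is connected. -/
def IsConnectedGraph (m n : ℕ) (s t : Fin m → Fin n) : Prop :=
  ∀ x y, Conn m n s t Set.univ x y

/-- `T ⊆ E` is a spanning tree: it has `n - 1` edges and connects all vertices. -/
def IsSpanningTree (m n : ℕ) (s t : Fin m → Fin n) (T : Finset (Fin m)) : Prop :=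
  T.card = n - 1 ∧ ∀ x y, Conn m n s t ↑T x y

/-- The reduced vertex incidence matrix `𝕀` (the distinguished vertex is the last one). -/
def inc (R : Type*) [Ring R] (m n' : ℕ) (s t : Fin m → Fin (n' + 1)) :
    Matrix (Fin m) (Fin n') R :=
  Matrix.of fun e j =>
    (if t e = Fin.castSucc j then (1 : R) else 0) -
      (if s e = Fin.castSucc j then (1 : R) else 0)

/-- `C` is a cycle incidence matrix: its columns lie in, and form a `ℤ`-basis of,
the lattice `{x : ℤ^E | 𝕀ᵀ x = 0}`. -/
def IsCycleMatrix (m n' ℓ : ℕ) (s t : Fin m → Fin (n' + 1))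
    (C : Matrix (Fin m) (Fin ℓ) ℤ) : Prop :=
  (inc ℤ m n' s t)ᵀ * C = 0 ∧
    ∀ x : Fin m → ℤ, (inc ℤ m n' s t)ᵀ.mulVec x = 0 →
      ∃! c : Fin ℓ → ℤ, C.mulVec c = x

/-- The concatenation `[X|Y]` of the columns of `X` and of `Y`, a square matrix. -/
def concat {R : Type*} {m ℓ c : ℕ} (h : ℓ + c = m) (X : Matrix (Fin m) (Fin ℓ) R)
    (Y : Matrix (Fin m) (Fin c) R) : Matrix (Fin m) (Fin m) R :=
  Matrix.of fun i j => Sum.elim (X i) (Y i) (finSumFinEquiv.symm (Fin.cast h.symm j))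

/-- The row submatrix `X[S]` (rows of `S` taken in increasing order);
junk value `0` if `S.card ≠ k`. -/
noncomputable def rowSub {R : Type*} [Zero R] {m c : ℕ} (X : Matrix (Fin m) (Fin c) R)
    (S : Finset (Fin m)) (k : ℕ) : Matrix (Fin k) (Fin c) R :=
  if h : S.card = k then Matrix.of fun i j => X ((S.orderIsoOfFin h) i : Fin m) j else 0

/-- The expanded vertex Laplacian `𝕄`, rows/columns indexed by edges and then vertices. -/
def MM (m n' : ℕ) (s t : Fin m → Fin (n' + 1)) (a : Fin m → ℝ) :
    Matrix (Fin (m + n')) (Fin (m + n')) ℝ :=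
  Matrix.of fun i j =>
    Matrix.fromBlocks (Matrix.diagonal a) (inc ℝ m n' s t) (-(inc ℝ m n' s t)ᵀ) 0
      (finSumFinEquiv.symm i) (finSumFinEquiv.symm j)

/-- The Symanzik polynomial `ψ_G = det 𝕄`. -/
noncomputable def psi (m n' : ℕ) (s t : Fin m → Fin (n' + 1)) (a : Fin m → ℝ) : ℝ :=
  (MM m n' s t a).det

/-- The Dodgson polynomial `ψ^{A,B}`: delete the rows in `A` and the columns in `B`
from `𝕄` (keeping the induced order) and take the determinant. -/
noncomputable def dodgson (m n' : ℕ) (s t : Fin m → Fin (n' + 1)) (a : Fin m → ℝ)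
    (A B : Finset (Fin (m + n'))) : ℝ :=
  if h : A.card = B.card then
    Matrix.det (Matrix.of fun i j : Fin (m + n' - A.card) =>
      MM m n' s t a
        ((Aᶜ.orderIsoOfFin (by simp [Finset.card_compl]) i : Fin (m + n')))
        ((Bᶜ.orderIsoOfFin (by simp [Finset.card_compl, h]) j : Fin (m + n'))))
  else 0

/-- Index of the edge `i` among the rows/columns of `𝕄`. -/
def edgeIdx (m n' : ℕ) (i : Fin m) : Fin (m + n') := Fin.castAdd n' i

/-- Index of the vertex `j` among the rows/columns of `𝕄`. -/
def vtxIdx (m n' : ℕ) (j : Fin n') : Fin (m + n') := Fin.natAdd m j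

/-- The edge Dodgson polynomial `ψ^{e_i,e_j}`. -/
noncomputable def dodgE (m n' : ℕ) (s t : Fin m → Fin (n' + 1)) (a : Fin m → ℝ)
    (i j : Fin m) : ℝ :=
  dodgson m n' s t a {edgeIdx m n' i} {edgeIdx m n' j}

/-- The vertex Dodgson polynomial `ψ^{v_i,v_j}`. -/
noncomputable def dodgV (m n' : ℕ) (s t : Fin m → Fin (n' + 1)) (a : Fin m → ℝ)
    (i j : Fin n') : ℝ :=
  dodgson m n' s t a {vtxIdx m n' i} {vtxIdx m n' j}

/-- The vertex Laplacian `L = 𝕀ᵀ D⁻¹ 𝕀`. -/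
noncomputable def vertexLap (m n' : ℕ) (s t : Fin m → Fin (n' + 1)) (a : Fin m → ℝ) :
    Matrix (Fin n') (Fin n') ℝ :=
  (inc ℝ m n' s t)ᵀ * Matrix.diagonal (fun i => (a i)⁻¹) * inc ℝ m n' s t

/-- The cycle Laplacian `Λ = 𝒞ᵀ D 𝒞`. -/
def cycleLap {m ℓ : ℕ} (a : Fin m → ℝ) (C : Matrix (Fin m) (Fin ℓ) ℤ) :
    Matrix (Fin ℓ) (Fin ℓ) ℝ :=
  (C.map (Int.cast : ℤ → ℝ))ᵀ * Matrix.diagonal a * C.map (Int.cast : ℤ → ℝ)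

/-- The degree-one generators `θ_i` of the exterior algebra `Ω`. -/
noncomputable def θ (m : ℕ) (i : Fin m) : ExteriorAlgebra ℝ (Fin m → ℝ) :=
  ExteriorAlgebra.ι ℝ (Pi.single i 1)

/-- The Pfaffian of a `2k × 2k` matrix with entries in the exterior algebra. -/
noncomputable def pfaffian {m N k : ℕ} (hk : N = 2 * k)
    (X : Matrix (Fin N) (Fin N) (ExteriorAlgebra ℝ (Fin m → ℝ))) :
    ExteriorAlgebra ℝ (Fin m → ℝ) :=
  ((2 ^ k * (Nat.factorial k : ℝ))⁻¹) •
    ∑ σ : Equiv.Perm (Fin N), (((Equiv.Perm.sign σ : ℤ) : ℝ)) •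
      (List.ofFn fun i : Fin k =>
        X (σ (Fin.cast hk.symm ⟨2 * i.1, by have := i.2; omega⟩))
          (σ (Fin.cast hk.symm ⟨2 * i.1 + 1, by have := i.2; omega⟩))).prod

/-- `dΛ = 𝒞ᵀ Θ 𝒞`, with `Θ = diag(θ_1, ..., θ_m)`, in the exterior algebra. -/
noncomputable def dLam {m ℓ : ℕ} (C : Matrix (Fin m) (Fin ℓ) ℤ) :
    Matrix (Fin ℓ) (Fin ℓ) (ExteriorAlgebra ℝ (Fin m → ℝ)) :=
  (C.map fun z => algebraMap ℝ (ExteriorAlgebra ℝ (Fin m → ℝ)) (z : ℝ))ᵀ *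
    Matrix.diagonal (θ m) *
    C.map fun z => algebraMap ℝ (ExteriorAlgebra ℝ (Fin m → ℝ)) (z : ℝ)

/-- The Pfaffian form `φ_G = (−2π)^{−ℓ/2} Pf(dΛ Λ⁻¹ dΛ) / √ψ_G`. -/
noncomputable def phiForm (m n' ℓ k : ℕ) (hk : ℓ = 2 * k)
    (s t : Fin m → Fin (n' + 1)) (a : Fin m → ℝ) (C : Matrix (Fin m) (Fin ℓ) ℤ) :
    ExteriorAlgebra ℝ (Fin m → ℝ) :=
  ((((-2) * Real.pi) ^ k)⁻¹ * (Real.sqrt (psi m n' s t a))⁻¹) •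
    pfaffian hk
      (dLam C * ((cycleLap a C)⁻¹).map (algebraMap ℝ (ExteriorAlgebra ℝ (Fin m → ℝ))) *
        dLam C)

open Classical in
/-- Sum of `F T` over all spanning trees `T` of the graph. -/
noncomputable def treeSum {β : Type*} [AddCommMonoid β] (m n' : ℕ)
    (s t : Fin m → Fin (n' + 1)) (F : Finset (Fin m) → β) : β :=
  ∑ T ∈ Finset.univ.filter (fun T : Finset (Fin m) => IsSpanningTree m (n' + 1) s t T), F T

open Classical in
/-- The number of spanning trees of the graph. -/
noncomputable def treeCount (m n' : ℕ) (s t : Fin m → Fin (n' + 1)) : ℕ :=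
  (Finset.univ.filter (fun T : Finset (Fin m) => IsSpanningTree m (n' + 1) s t T)).card

/-- The summand of `α_G` corresponding to a spanning tree `T`. -/
noncomputable def alphaTerm {m n' ℓ k : ℕ} (hk : ℓ = 2 * k)
    (s t : Fin m → Fin (n' + 1)) (a : Fin m → ℝ) (T : Finset (Fin m)) :
    ExteriorAlgebra ℝ (Fin m → ℝ) :=
  if h : Tᶜ.card = ℓ then
    ((rowSub (inc ℝ m n' s t) T n').det *
        ∑ σ : Equiv.Perm (Fin ℓ), ∏ i : Fin k,
          dodgE m n' s t a
            ((Tᶜ.orderIsoOfFin h) (σ (Fin.cast hk.symm ⟨2 * i.1, by have := i.2; omega⟩)) : Fin m)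
            ((Tᶜ.orderIsoOfFin h) (σ (Fin.cast hk.symm ⟨2 * i.1 + 1, by have := i.2; omega⟩)) : Fin m)) •
      (List.ofFn fun j : Fin ℓ => θ m ((Tᶜ.orderIsoOfFin h) j : Fin m)).prod
  else 0

/-- The topological form `α_G`. -/
noncomputable def alphaForm (m n' ℓ k : ℕ) (hk : ℓ = 2 * k)
    (s t : Fin m → Fin (n' + 1)) (a : Fin m → ℝ) :
    ExteriorAlgebra ℝ (Fin m → ℝ) :=
  ((Real.pi ^ k * 4 ^ ℓ * (Nat.factorial k : ℝ) *
      psi m n' s t a ^ (((ℓ : ℝ) + 1) / 2))⁻¹) •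
    treeSum m n' s t (alphaTerm hk s t a)

/-- A walk in the graph, with signed edge traversals. -/
structure GWalk (m n : ℕ) (s t : Fin m → Fin n) (k : ℕ) where
  g : Fin k → Fin m
  ε : Fin k → ℤ
  u : Fin (k + 1) → Fin n
  hε : ∀ i, ε i = 1 ∨ ε i = -1
  hstep : ∀ i : Fin k,
    (ε i = 1 → s (g i) = u i.castSucc ∧ t (g i) = u i.succ) ∧
    (ε i = -1 → s (g i) = u i.succ ∧ t (g i) = u i.castSucc)

/-- The signed incidence vector of a walk. -/
def GWalk.vec {m n k : ℕ} {s t : Fin m → Fin n} (W : GWalk m n s t k) : Fin m → ℤ :=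
  fun e => ∑ i : Fin k, if W.g i = e then W.ε i else 0

/-- The lift of a vector along the subdivision of the edge `k` into two edges. -/
def liftVec {m : ℕ} (k : Fin m) (x : Fin m → ℤ) : Fin (m + 1) → ℤ :=
  fun i => if _ : i.1 ≤ k.1 then x ⟨i.1, by have := k.2; omega⟩
    else x ⟨i.1 - 1, by have := i.2; omega⟩


theorem inc_mulVec_apply (m n' : ℕ) (s t : Fin m → Fin (n' + 1)) (x : Fin n' → ℝ) (e : Fin m) :
    (inc ℝ m n' s t).mulVec x e =
      Fin.snoc (α := fun _ => ℝ) x 0 (t e) - Fin.snoc (α := fun _ => ℝ) x 0 (s e) := by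
  have key : ∀ v : Fin (n' + 1),
      ∑ j, (if v = Fin.castSucc j then (1 : ℝ) else 0) * x j =
        Fin.snoc (α := fun _ => ℝ) x 0 v := by
    intro v
    refine Fin.lastCases ?_ (fun k => ?_) v
    · simp [(Fin.castSucc_lt_last _).ne']
    · simp [Fin.castSucc_inj]
  simp only [inc, Matrix.mulVec, dotProduct, Matrix.of_apply, sub_mul, Finset.sum_sub_distrib, key]

theorem inc_mulVec_injective {m n' : ℕ} {s t : Fin m → Fin (n' + 1)}
    (hconn : IsConnectedGraph m (n' + 1) s t) :
    Function.Injective (inc ℝ m n' s t).mulVec := by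
  rw [← Matrix.coe_mulVecLin, ← LinearMap.ker_eq_bot, LinearMap.ker_eq_bot']
  intro x hx
  have hedge : ∀ e, Fin.snoc (α := fun _ => ℝ) x 0 (t e) =
      Fin.snoc (α := fun _ => ℝ) x 0 (s e) := fun e => by
    have h := congrFun hx e
    rw [Matrix.mulVecLin_apply, inc_mulVec_apply] at h
    exact sub_eq_zero.mp h
  have hconst : ∀ u v, Fin.snoc (α := fun _ => ℝ) x 0 u = Fin.snoc (α := fun _ => ℝ) x 0 v := by
    intro u v
    induction hconn u v with
    | refl => rfl
    | tail _ hstep ih =>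
      obtain ⟨e, -, ⟨rfl, rfl⟩ | ⟨rfl, rfl⟩⟩ := hstep
      · rw [ih, hedge]
      · rw [ih, hedge]
  ext j
  simpa using hconst (Fin.castSucc j) (Fin.last n')

theorem vertexLap_posDef {m n' : ℕ} {s t : Fin m → Fin (n' + 1)}
    (hconn : IsConnectedGraph m (n' + 1) s t) {a : Fin m → ℝ} (ha : ∀ i, 0 < a i) :
    (vertexLap m n' s t a).PosDef := by
  have hD : (Matrix.diagonal fun i => (a i)⁻¹).PosDef :=
    Matrix.PosDef.diagonal fun i => inv_pos.mpr (ha i)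
  simpa [vertexLap, Matrix.conjTranspose_eq_transpose_of_trivial] using
    hD.conjTranspose_mul_mul_same (inc_mulVec_injective hconn)

theorem vertexLap_transpose (m n' : ℕ) (s t : Fin m → Fin (n' + 1)) (a : Fin m → ℝ) :
    (vertexLap m n' s t a)ᵀ = vertexLap m n' s t a := by
  simp [vertexLap, Matrix.transpose_mul, Matrix.mul_assoc]

theorem MM_eq_submatrix (m n' : ℕ) (s t : Fin m → Fin (n' + 1)) (a : Fin m → ℝ) :
    MM m n' s t a =
      (Matrix.fromBlocks (Matrix.diagonal a) (inc ℝ m n' s t) (-(inc ℝ m n' s t)ᵀ) 0).submatrix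
        finSumFinEquiv.symm finSumFinEquiv.symm :=
  rfl

/-- A two-by-two block matrix with vanishing lower right block is inverted through
its Schur complement. -/
theorem fromBlocks_mul_schur_inverse {ι κ : Type*} [Fintype ι] [DecidableEq ι] [Fintype κ]
    [DecidableEq κ] {D D' : Matrix ι ι ℝ} (B : Matrix ι κ ℝ) {L' : Matrix κ κ ℝ}
    (hD : D * D' = 1) (hL : Bᵀ * D' * B * L' = 1) :
    Matrix.fromBlocks D B (-Bᵀ) 0 *
      Matrix.fromBlocks (D' - D' * B * L' * Bᵀ * D') (-(D' * B * L')) (L' * Bᵀ * D') L' = 1 := by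
  rw [Matrix.fromBlocks_multiply, ← Matrix.fromBlocks_one]
  have hLX : ∀ (X : Matrix κ ι ℝ), Bᵀ * (D' * (B * (L' * X))) = X := by
    intro X
    simp only [← Matrix.mul_assoc, hL, Matrix.one_mul]
  have hL2 : Bᵀ * (D' * (B * L')) = 1 := by simpa only [Matrix.mul_assoc] using hL
  congr 1
  · rw [Matrix.mul_sub, hD]
    simp only [Matrix.mul_assoc]
    rw [← Matrix.mul_assoc D D', hD, Matrix.one_mul, sub_add_cancel]
  · simp only [Matrix.mul_assoc, Matrix.mul_neg]
    rw [← Matrix.mul_assoc D D', hD, Matrix.one_mul, neg_add_cancel]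
  · simp only [Matrix.mul_assoc, Matrix.mul_sub, Matrix.neg_mul, hLX]
    simp
  · simp only [Matrix.mul_assoc, Matrix.neg_mul, Matrix.mul_neg, hL2]
    simp

section Connected

variable {m n' : ℕ} {s t : Fin m → Fin (n' + 1)} {a : Fin m → ℝ}

theorem MM_mul_schur_inverse (hconn : IsConnectedGraph m (n' + 1) s t) (ha : ∀ i, 0 < a i) :
    MM m n' s t a *
      (Matrix.fromBlocks
        (Matrix.diagonal (fun e => (a e)⁻¹) - Matrix.diagonal (fun e => (a e)⁻¹) *
          inc ℝ m n' s t * (vertexLap m n' s t a)⁻¹ * (inc ℝ m n' s t)ᵀ *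
          Matrix.diagonal (fun e => (a e)⁻¹))
        (-(Matrix.diagonal (fun e => (a e)⁻¹) * inc ℝ m n' s t * (vertexLap m n' s t a)⁻¹))
        ((vertexLap m n' s t a)⁻¹ * (inc ℝ m n' s t)ᵀ * Matrix.diagonal (fun e => (a e)⁻¹))
        (vertexLap m n' s t a)⁻¹).submatrix finSumFinEquiv.symm finSumFinEquiv.symm = 1 := by
  have hD : Matrix.diagonal a * Matrix.diagonal (fun e => (a e)⁻¹) = 1 := by
    rw [Matrix.diagonal_mul_diagonal, ← Matrix.diagonal_one]
    exact congrArg _ (funext fun e => mul_inv_cancel₀ (ha e).ne')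
  have hL : vertexLap m n' s t a * (vertexLap m n' s t a)⁻¹ = 1 :=
    Matrix.mul_nonsing_inv _
      ((Matrix.isUnit_iff_isUnit_det _).mp (vertexLap_posDef hconn ha).isUnit)
  rw [MM_eq_submatrix, Matrix.submatrix_mul_equiv, fromBlocks_mul_schur_inverse _ hD hL,
    Matrix.submatrix_one_equiv]

theorem psi_ne_zero (hconn : IsConnectedGraph m (n' + 1) s t) (ha : ∀ i, 0 < a i) :
    psi m n' s t a ≠ 0 :=
  (Matrix.isUnit_det_of_right_inverse (MM_mul_schur_inverse hconn ha)).ne_zero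

theorem MM_inv_edge_apply (hconn : IsConnectedGraph m (n' + 1) s t) (ha : ∀ i, 0 < a i)
    (i j : Fin m) :
    (MM m n' s t a)⁻¹ (edgeIdx m n' i) (edgeIdx m n' j) =
      (Matrix.diagonal (fun e => (a e)⁻¹) - Matrix.diagonal (fun e => (a e)⁻¹) *
        inc ℝ m n' s t * (vertexLap m n' s t a)⁻¹ * (inc ℝ m n' s t)ᵀ *
        Matrix.diagonal (fun e => (a e)⁻¹)) i j := by
  rw [Matrix.inv_eq_right_inv (MM_mul_schur_inverse hconn ha)]
  simp [edgeIdx]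

theorem MM_inv_edge_symm (hconn : IsConnectedGraph m (n' + 1) s t) (ha : ∀ i, 0 < a i)
    (i j : Fin m) :
    (MM m n' s t a)⁻¹ (edgeIdx m n' i) (edgeIdx m n' j) =
      (MM m n' s t a)⁻¹ (edgeIdx m n' j) (edgeIdx m n' i) := by
  rw [MM_inv_edge_apply hconn ha, MM_inv_edge_apply hconn ha]
  conv_rhs => rw [← Matrix.transpose_apply (_ - _) i j]
  simp only [Matrix.transpose_sub, Matrix.transpose_mul, Matrix.diagonal_transpose,
    Matrix.transpose_transpose, Matrix.transpose_nonsing_inv, vertexLap_transpose,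
    Matrix.mul_assoc]

theorem projector_entry_eq (hconn : IsConnectedGraph m (n' + 1) s t) (ha : ∀ i, 0 < a i)
    (i j : Fin m) :
    (Matrix.diagonal (fun e => (a e)⁻¹) * inc ℝ m n' s t * (vertexLap m n' s t a)⁻¹ *
        (inc ℝ m n' s t)ᵀ) i j =
      (if i = j then 1 else 0) -
        a j * (MM m n' s t a)⁻¹ (edgeIdx m n' i) (edgeIdx m n' j) := by
  rw [MM_inv_edge_apply hconn ha, Matrix.sub_apply, Matrix.mul_diagonal, Matrix.diagonal_apply]
  have := (ha j).ne'
  split_ifs with h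
  · subst h
    field_simp
    ring
  · field_simp
    ring

end Connected

theorem MM_inv_apply (m n' : ℕ) (s t : Fin m → Fin (n' + 1)) (a : Fin m → ℝ)
    (p q : Fin (m + n')) :
    (MM m n' s t a)⁻¹ p q = (MM m n' s t a).adjugate p q / psi m n' s t a := by
  rw [Matrix.inv_def, Matrix.smul_apply, Ring.inverse_eq_inv', smul_eq_mul, psi, mul_comm,
    div_eq_mul_inv]

theorem coe_orderIsoOfFin_compl_singleton {k : ℕ} (p : Fin (k + 1))
    (h : ({p}ᶜ : Finset (Fin (k + 1))).card = k) (i : Fin k) :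
    ((({p}ᶜ : Finset (Fin (k + 1))).orderIsoOfFin h i : Fin (k + 1))) = p.succAbove i := by
  have := Finset.orderEmbOfFin_unique h (f := p.succAbove)
    (fun x => by simp [Fin.succAbove_ne]) (Fin.strictMono_succAbove p)
  rw [Finset.coe_orderIsoOfFin_apply, this]

theorem det_submatrix_compl_singleton {N : ℕ} (A : Matrix (Fin N) (Fin N) ℝ) (p q : Fin N)
    (hp : ({p}ᶜ : Finset (Fin N)).card = N - 1) (hq : ({q}ᶜ : Finset (Fin N)).card = N - 1) :
    (Matrix.of fun i j : Fin (N - 1) =>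
      A (({p}ᶜ : Finset (Fin N)).orderIsoOfFin hp i) (({q}ᶜ : Finset (Fin N)).orderIsoOfFin hq j)).det
      = (-1) ^ ((p : ℕ) + q) * A.adjugate q p := by
  obtain _ | k := N
  · exact p.elim0
  · rw [Matrix.adjugate_fin_succ_eq_det_submatrix, ← mul_assoc, ← mul_pow]
    simp only [mul_neg, mul_one, neg_neg, one_pow, one_mul]
    congr 1
    ext i j
    exact congrArg₂ A (coe_orderIsoOfFin_compl_singleton p hp i)
      (coe_orderIsoOfFin_compl_singleton q hq j)

theorem dodgE_eq_adjugate (m n' : ℕ) (s t : Fin m → Fin (n' + 1)) (a : Fin m → ℝ) (i j : Fin m) :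
    dodgE m n' s t a i j =
      (-1) ^ ((i : ℕ) + j) * (MM m n' s t a).adjugate (edgeIdx m n' j) (edgeIdx m n' i) := by
  rw [dodgE, dodgson, dif_pos (by simp)]
  exact det_submatrix_compl_singleton (MM m n' s t a) (edgeIdx m n' i) (edgeIdx m n' j) _ _

theorem psi_update_zero (m n' : ℕ) (s t : Fin m → Fin (n' + 1)) (a : Fin m → ℝ) (i : Fin m) :
    psi m n' s t (Function.update a i 0) =
      psi m n' s t a - a i * (MM m n' s t a).adjugate (edgeIdx m n' i) (edgeIdx m n' i) := by
  have h : MM m n' s t (Function.update a i 0) =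
      (MM m n' s t a).updateRow (edgeIdx m n' i)
        (MM m n' s t a (edgeIdx m n' i) + (-a i) • Pi.single (edgeIdx m n' i) 1) := by
    ext p q
    obtain ⟨p, rfl⟩ := finSumFinEquiv.surjective p
    obtain ⟨q, rfl⟩ := finSumFinEquiv.surjective q
    have he : edgeIdx m n' i = finSumFinEquiv (Sum.inl i) := rfl
    rw [he, Matrix.updateRow_apply]
    simp only [MM, Matrix.of_apply, Pi.add_apply, Pi.smul_apply, Pi.single_apply,
      EmbeddingLike.apply_eq_iff_eq, Equiv.symm_apply_apply, smul_eq_mul]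
    rcases p with p | p <;> rcases q with q | q
    · simp only [Matrix.fromBlocks_apply₁₁, Matrix.diagonal_apply, Function.update_apply,
        Sum.inl.injEq]
      grind
    all_goals simp +contextual
  rw [psi, h, Matrix.det_updateRow_add, Matrix.det_updateRow_smul, Matrix.updateRow_eq_self,
    ← Matrix.adjugate_apply, psi]
  ring

/-- **Entries of `D⁻¹𝕀L⁻¹𝕀ᵀ` as Dodgson polynomials.** -/
theorem projector_entries_dodgson (m n' : ℕ) (s t : Fin m → Fin (n' + 1))
    (hconn : IsConnectedGraph m (n' + 1) s t)
    (a : Fin m → ℝ) (ha : ∀ i, 0 < a i) :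
    (∀ i j : Fin m,
      (Matrix.diagonal (fun e => (a e)⁻¹) * inc ℝ m n' s t * (vertexLap m n' s t a)⁻¹ *
          (inc ℝ m n' s t)ᵀ) i j =
        (if i = j then 1 else 0) -
          (-1 : ℝ) ^ (((i : ℕ) + 1) + ((j : ℕ) + 1)) * a j * dodgE m n' s t a i j /
            psi m n' s t a) ∧
    (∀ i : Fin m,
      (Matrix.diagonal (fun e => (a e)⁻¹) * inc ℝ m n' s t * (vertexLap m n' s t a)⁻¹ *
          (inc ℝ m n' s t)ᵀ) i i =
        psi m n' s t (Function.update a i 0) / psi m n' s t a) := by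
  refine ⟨fun i j => ?_, fun i => ?_⟩
  · rw [projector_entry_eq hconn ha, MM_inv_edge_symm hconn ha, MM_inv_apply, dodgE_eq_adjugate]
    have hsign : (-1 : ℝ) ^ ((i : ℕ) + 1 + (j + 1)) * (-1) ^ ((i : ℕ) + j) = 1 := by
      rw [← pow_add]
      exact Even.neg_one_pow ⟨i + j + 1, by ring⟩
    linear_combination
      (a j * ((MM m n' s t a).adjugate (edgeIdx m n' j) (edgeIdx m n' i) / psi m n' s t a)) * hsign
  · rw [projector_entry_eq hconn ha, MM_inv_apply, psi_update_zero, if_pos rfl, sub_div,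
      div_self (psi_ne_zero hconn ha), mul_div_assoc]
end GraphForms
end

section
/- Inverse cycle Laplacian of a fundamental cycle basis. Let G be a connected graph with positive Schwinger parameters, let T be a spanning tree with complement E ∖ T = {f_1 < ... < f_ℓ} where f_i = e_{k_i}, and let 𝒯 be an m × ℓ integer matrix with 𝕀ᵀ 𝒯 = 0 whose submatrix of rows f_1, ..., f_ℓ equals the identity matrix 1_ℓ (the fundamental cycle matrix associated to T). Then Λ_𝒯 := 𝒯ᵀ D 𝒯 is invertible and for all 1 ≤ i, j ≤ ℓ, (Λ_𝒯⁻¹)_{i,j} = (−1)^{k_i + k_j} ψ^{f_i,f_j} / ψ_G. -/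
open Matrix BigOperators

namespace GraphForms

/-- A vector killed by the reduced incidence matrix restricted to a connecting set of edges
vanishes. -/
theorem eq_zero_of_forall_inc_mulVec_eq_zero {m n' : ℕ} {s t : Fin m → Fin (n' + 1)}
    {T : Finset (Fin m)} (hT : ∀ x y, Conn m (n' + 1) s t ↑T x y) {y : Fin n' → ℝ}
    (hy : ∀ e ∈ T, (inc ℝ m n' s t *ᵥ y) e = 0) : y = 0 := by
  set z : Fin (n' + 1) → ℝ := Fin.snoc y 0
  have hz (w : Fin (n' + 1)) : ∑ j, (if w = Fin.castSucc j then (1 : ℝ) else 0) * y j = z w := by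
    induction w using Fin.lastCases with
    | last =>
      simp [z, Fin.snoc_last, (Fin.castSucc_lt_last _).ne']
    | cast i => simp [z]
  have hinc (e : Fin m) : (inc ℝ m n' s t *ᵥ y) e = z (t e) - z (s e) := by
    simp only [Matrix.mulVec, dotProduct, inc, Matrix.of_apply, sub_mul, Finset.sum_sub_distrib, hz]
  have hconst (v w : Fin (n' + 1)) : z v = z w := by
    have h : Conn m (n' + 1) s t ↑T v w := hT v w
    induction h with
    | refl => rfl
    | tail _ hstep ih =>
      obtain ⟨e, he, h⟩ := hstep
      have h0 := hy e he
      rw [hinc] at h0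
      rcases h with ⟨rfl, rfl⟩ | ⟨rfl, rfl⟩ <;> linarith
  funext j
  simpa [z] using hconst (Fin.castSucc j) (Fin.last n')

/-- A cycle vanishing off a spanning tree vanishes. -/
theorem IsSpanningTree.eq_zero_of_vecMul_inc_eq_zero {m n' : ℕ} {s t : Fin m → Fin (n' + 1)}
    {T : Finset (Fin m)} (hT : IsSpanningTree m (n' + 1) s t T) {x : Fin m → ℝ}
    (hx : x ᵥ* inc ℝ m n' s t = 0) (hoff : ∀ e ∉ T, x e = 0) : x = 0 := by
  have hcard : T.card = n' := by simpa using hT.1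
  let φ : Fin n' ≃ T := (T.orderIsoOfFin hcard).toEquiv
  let B : Matrix (Fin n') (Fin n') ℝ := (inc ℝ m n' s t).submatrix (fun i => (φ i : Fin m)) id
  have hB : B.det ≠ 0 := by
    rw [Ne, ← Matrix.exists_mulVec_eq_zero_iff]
    rintro ⟨y, hy0, hy⟩
    refine hy0 (eq_zero_of_forall_inc_mulVec_eq_zero hT.2 fun e he => ?_)
    simpa [B, Matrix.mulVec, dotProduct] using congrFun hy (φ.symm ⟨e, he⟩)
  have hxT : (fun i => x (φ i)) = 0 := by
    by_contra h
    refine hB (Matrix.exists_vecMul_eq_zero_iff.1 ⟨_, h, ?_⟩)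
    funext j
    have hj := congrFun hx j
    simp only [Matrix.vecMul, dotProduct, Pi.zero_apply] at hj ⊢
    rw [← hj, ← Finset.sum_subset (Finset.subset_univ T)
      (fun e _ he => by rw [hoff e he, zero_mul]), ← Finset.sum_coe_sort T]
    exact Equiv.sum_comp φ fun e : T => x e * inc ℝ m n' s t e j
  funext e
  by_cases he : e ∈ T
  · simpa using congrFun hxT (φ.symm ⟨e, he⟩)
  · exact hoff e he

/-- The expanded vertex Laplacian of a connected graph is nonsingular. -/
theorem det_fromBlocks_inc_ne_zero {m n' : ℕ} {s t : Fin m → Fin (n' + 1)}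
    (hconn : IsConnectedGraph m (n' + 1) s t) {a : Fin m → ℝ} (ha : ∀ e, 0 < a e) :
    (Matrix.fromBlocks (Matrix.diagonal a) (inc ℝ m n' s t) (-(inc ℝ m n' s t)ᵀ) 0).det ≠ 0 := by
  rw [Ne, ← Matrix.exists_mulVec_eq_zero_iff]
  rintro ⟨v, hv0, hv⟩
  obtain ⟨x, y, rfl⟩ : ∃ x y, v = Sum.elim x y := ⟨_, _, (Sum.elim_comp_inl_inr v).symm⟩
  rw [Matrix.fromBlocks_mulVec, ← Sum.elim_zero_zero, Sum.elim_eq_iff] at hv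
  simp only [Sum.elim_comp_inl, Sum.elim_comp_inr, Matrix.neg_mulVec, Matrix.mulVec_transpose,
    Matrix.zero_mulVec, add_zero, neg_eq_zero] at hv
  obtain ⟨h₁, h₂⟩ := hv
  have hquad : ∑ e, a e * x e ^ 2 = 0 := by
    have h := congrArg (x ⬝ᵥ ·) h₁
    simp only [dotProduct_add, Matrix.dotProduct_mulVec x (inc ℝ m n' s t), h₂, zero_dotProduct,
      add_zero, dotProduct_zero] at h
    rw [← h]
    exact Finset.sum_congr rfl fun e _ => by rw [Matrix.mulVec_diagonal]; ring
  have hx : x = 0 := by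
    funext e
    have h := (Finset.sum_eq_zero_iff_of_nonneg
      fun e _ => mul_nonneg (ha e).le (sq_nonneg (x e))).1 hquad e (Finset.mem_univ e)
    simpa [(ha e).ne'] using h
  subst hx
  rw [Matrix.mulVec_zero, zero_add] at h₁
  have hy : y = 0 := eq_zero_of_forall_inc_mulVec_eq_zero (T := Finset.univ) (s := s) (t := t)
    (by simpa [IsConnectedGraph] using hconn) fun e _ => congrFun h₁ e
  subst hy
  exact hv0 Sum.elim_zero_zero

/-- Up to sign, the minor of a matrix complementary to an entry is an entry of the adjugate. -/
theorem adjugate_eq_det_orderIsoOfFin_compl {R : Type*} [CommRing R] {N : ℕ}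
    (A : Matrix (Fin N) (Fin N) R) (i j : Fin N)
    (hi : ({i}ᶜ : Finset (Fin N)).card = N - 1) (hj : ({j}ᶜ : Finset (Fin N)).card = N - 1) :
    A.adjugate j i = (-1) ^ (i + j : ℕ) *
      (Matrix.of fun p q : Fin (N - 1) =>
        A (({i}ᶜ : Finset (Fin N)).orderIsoOfFin hi p)
          (({j}ᶜ : Finset (Fin N)).orderIsoOfFin hj q)).det := by
  cases N with
  | zero => exact i.elim0
  | succ k =>
    rw [Matrix.adjugate_fin_succ_eq_det_submatrix]
    congr 2
    ext p q
    simp only [Matrix.submatrix_apply, Matrix.of_apply, Finset.coe_orderIsoOfFin_apply]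
    rw [Finset.orderEmbOfFin_compl_singleton_apply, Finset.orderEmbOfFin_compl_singleton_apply]
    rfl

/-- Edge Dodgson polynomials are, up to sign and division by the Symanzik polynomial, the entries
of the edge block of the inverse of the expanded vertex Laplacian. -/
theorem inv_fromBlocks_inc_apply_inl_inl (m n' : ℕ) (s t : Fin m → Fin (n' + 1)) (a : Fin m → ℝ)
    (i j : Fin m) :
    (Matrix.fromBlocks (Matrix.diagonal a) (inc ℝ m n' s t) (-(inc ℝ m n' s t)ᵀ) 0)⁻¹
        (Sum.inl j) (Sum.inl i) =
      (-1) ^ (i + j : ℕ) * dodgE m n' s t a i j / psi m n' s t a := by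
  have hinv := congrFun₂ (Matrix.inv_submatrix_equiv (Matrix.fromBlocks (Matrix.diagonal a)
    (inc ℝ m n' s t) (-(inc ℝ m n' s t)ᵀ) 0) finSumFinEquiv.symm finSumFinEquiv.symm)
    (edgeIdx m n' j) (edgeIdx m n' i)
  rw [← MM_eq_submatrix, Matrix.submatrix_apply, edgeIdx, edgeIdx,
    finSumFinEquiv_symm_apply_castAdd, finSumFinEquiv_symm_apply_castAdd] at hinv
  rw [← hinv, Matrix.inv_def, Matrix.smul_apply, Ring.inverse_eq_inv', smul_eq_mul, psi,
    div_eq_inv_mul, adjugate_eq_det_orderIsoOfFin_compl _ _ _ (by simp [Finset.card_compl])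
      (by simp [Finset.card_compl])]
  rfl

/-- **Inverse cycle Laplacian of a fundamental cycle basis.** -/
theorem fundamental_cycle_laplacian_inverse (m n' ℓ : ℕ) (s t : Fin m → Fin (n' + 1))
    (hconn : IsConnectedGraph m (n' + 1) s t) (hm : ℓ + n' = m)
    (a : Fin m → ℝ) (ha : ∀ e, 0 < a e)
    (T : Finset (Fin m)) (hT : IsSpanningTree m (n' + 1) s t T)
    (hc : Tᶜ.card = ℓ)
    (𝒯 : Matrix (Fin m) (Fin ℓ) ℤ)
    (h𝒯₁ : (inc ℤ m n' s t)ᵀ * 𝒯 = 0)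
    (h𝒯₂ : rowSub 𝒯 Tᶜ ℓ = 1) :
    IsUnit (cycleLap a 𝒯).det ∧
    ∀ i j : Fin ℓ,
      (cycleLap a 𝒯)⁻¹ i j =
        (-1 : ℝ) ^
            (((((Tᶜ.orderIsoOfFin hc) i : Fin m) : ℕ) + 1) +
              ((((Tᶜ.orderIsoOfFin hc) j : Fin m) : ℕ) + 1)) *
          dodgE m n' s t a ((Tᶜ.orderIsoOfFin hc) i : Fin m)
            ((Tᶜ.orderIsoOfFin hc) j : Fin m) /
          psi m n' s t a := by
  set I := inc ℝ m n' s t with hI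
  set C : Matrix (Fin m) (Fin ℓ) ℝ := 𝒯.map (Int.cast : ℤ → ℝ)
  set f : Fin ℓ → Fin m := fun i => (Tᶜ.orderIsoOfFin hc) i
  set M := Matrix.fromBlocks (Matrix.diagonal a) I (-Iᵀ) 0 with hM
  set K := M⁻¹.toBlocks₁₁ with hK
  have hIC : Cᵀ * I = 0 := by
    have h := congrArg (fun X => (X.map (Int.castRingHom ℝ))ᵀ) h𝒯₁
    simp only [Matrix.map_mul, Matrix.transpose_mul] at h
    convert h using 1
    · congr 1
      ext e j
      simp [hI, inc, apply_ite (Int.cast : ℤ → ℝ)]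
    · ext
      simp
  have hCf : C.submatrix f id = 1 := by
    rw [rowSub, dif_pos hc] at h𝒯₂
    ext i j
    have h := congrArg (Int.cast : ℤ → ℝ) (congrFun₂ h𝒯₂ i j)
    simpa [C, f, Matrix.one_apply, apply_ite (Int.cast : ℤ → ℝ)] using h
  have hblocks : M * M⁻¹ = 1 :=
    Matrix.mul_nonsing_inv _ (isUnit_iff_ne_zero.2 (det_fromBlocks_inc_ne_zero hconn ha))
  rw [← Matrix.fromBlocks_toBlocks M⁻¹, hM, Matrix.fromBlocks_multiply, ← Matrix.fromBlocks_one,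
    Matrix.fromBlocks_inj] at hblocks
  obtain ⟨h₁, -, h₂, -⟩ := hblocks
  rw [← hM, ← hK] at h₁ h₂
  have hIK : Iᵀ * K = 0 := by simpa using h₂
  have hKC : K = C * K.submatrix f id := by
    rw [← sub_eq_zero]
    refine Matrix.ext_col fun e => ?_
    refine hT.eq_zero_of_vecMul_inc_eq_zero ?_ fun g hg => ?_
    · rw [← Matrix.mulVec_transpose]
      have h : Iᵀ * (K - C * K.submatrix f id) = 0 := by
        rw [Matrix.mul_sub, hIK, ← Matrix.mul_assoc, ← Matrix.transpose_transpose C,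
          ← Matrix.transpose_mul, hIC]
        simp
      funext j
      exact congrFun₂ h j e
    · obtain ⟨i, rfl⟩ : ∃ i, f i = g :=
        ⟨(Tᶜ.orderIsoOfFin hc).symm ⟨g, by simpa using hg⟩, by simp [f, -Finset.coe_orderIsoOfFin_apply]⟩
      have h : (C * K.submatrix f id).submatrix f id = K.submatrix f id := by
        rw [Matrix.submatrix_mul C _ f id id Function.bijective_id, hCf, Matrix.submatrix_id_id,
          Matrix.one_mul]
      have h' := congrFun₂ h i e
      simp only [Matrix.submatrix_apply, id] at h'
      simp [Matrix.col, h']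
  have hmul : cycleLap a 𝒯 * K.submatrix f f = 1 := by
    have h : cycleLap a 𝒯 * K.submatrix f id = Cᵀ := by
      have h' := congrArg (Cᵀ * ·) h₁
      simp only [Matrix.mul_add, Matrix.mul_one] at h'
      rw [← Matrix.mul_assoc Cᵀ I, hIC, Matrix.zero_mul, add_zero, hKC] at h'
      simpa only [cycleLap, Matrix.mul_assoc] using h'
    have h' := congrArg (fun X => X.submatrix id f) h
    simp only [Matrix.submatrix_mul _ _ id id f Function.bijective_id] at h'
    calc cycleLap a 𝒯 * K.submatrix f f = Cᵀ.submatrix id f := h'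
      _ = (C.submatrix f id)ᵀ := rfl
      _ = 1 := by rw [hCf, Matrix.transpose_one]
  have hsymm : (cycleLap a 𝒯)ᵀ = cycleLap a 𝒯 := by
    simp [cycleLap, Matrix.transpose_mul, Matrix.mul_assoc]
  refine ⟨(Matrix.isUnit_iff_isUnit_det _).1 (.of_mul_eq_one _ hmul), fun i j => ?_⟩
  have hji : (cycleLap a 𝒯)⁻¹ i j = M⁻¹ (Sum.inl (f j)) (Sum.inl (f i)) := by
    rw [← hsymm, ← Matrix.transpose_nonsing_inv, Matrix.inv_eq_right_inv hmul]
    rfl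
  rw [hji, inv_fromBlocks_inc_apply_inl_inl]
  congr 2
  ring

end GraphForms
end

section
/- Sign change of the concatenated determinant under edge subdivision. Let G be a connected graph with even loop number ℓ, and let e_k be an edge with tail v = s(e_k) and head w = t(e_k). Let G' be the graph obtained by subdividing e_k: its vertex set is V' = {v'_1 < ... < v'_{n+1}} where v'_1 is a new vertex and v'_{j+1} = v_j for 1 ≤ j ≤ n (so the distinguished vertex of G' is still v⋆ = v'_{n+1}); its edge set is E' = {e'_1 < ... < e'_{m+1}} where e'_j = e_j for j < k, e'_k is an edge from v to v'_1, e'_{k+1} is an edge from v'_1 to w, and e'_{j+1} = e_j for j > k. Let 𝒞 be a cycle incidence matrix of G and let 𝒫 be any m × (n−1) integer matrix with 𝒫ᵀ 𝕀 = 1_{n−1}. For a vector x ∈ ℤ^E, its lift x' ∈ ℤ^{E'} is defined by x'_{e'_k} = x'_{e'_{k+1}} = x_{e_k} and x'_{e'} = x_e for every other edge e' corresponding to e. Define the (m+1) × ℓ matrix 𝒞' whose columns are the lifts of the columns of 𝒞, and define the (m+1) × n matrix 𝒫' whose column for vertex v'_{j+1} (1 ≤ j ≤ n−1) is the lift of the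 j-th column of 𝒫, and whose column for the new vertex v'_1 is the lift of the column of 𝒫 for v (the zero vector if v = v⋆) plus the standard unit vector at e'_k; the columns of 𝒫' are ordered by the vertex order v'_1, v'_2, ..., v'_n. Then det[𝒞'|𝒫'] = (−1)^{k+1} · det[𝒞|𝒫]. -/
open Matrix BigOperators

namespace GraphForms

theorem concat_cast_castAdd {R : Type*} {m ℓ c : ℕ} (h : ℓ + c = m)
    (X : Matrix (Fin m) (Fin ℓ) R) (Y : Matrix (Fin m) (Fin c) R) (i : Fin m) (j : Fin ℓ) :
    concat h X Y i (Fin.cast h (Fin.castAdd c j)) = X i j := by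
  simp [concat]

theorem concat_cast_natAdd {R : Type*} {m ℓ c : ℕ} (h : ℓ + c = m)
    (X : Matrix (Fin m) (Fin ℓ) R) (Y : Matrix (Fin m) (Fin c) R) (i : Fin m) (j : Fin c) :
    concat h X Y i (Fin.cast h (Fin.natAdd ℓ j)) = Y i j := by
  simp [concat]

theorem liftVec_castSucc {m : ℕ} (k : Fin m) (x : Fin m → ℤ) :
    liftVec k x k.castSucc = x k := by
  simp [liftVec]

theorem liftVec_succ {m : ℕ} (k : Fin m) (x : Fin m → ℤ) :
    liftVec k x k.succ = x k := by
  simp [liftVec]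

theorem liftVec_succAbove {m : ℕ} (k : Fin m) (x : Fin m → ℤ) (i : Fin m) :
    liftVec k x (k.castSucc.succAbove i) = x i := by
  rcases lt_or_ge i k with h | h
  · rw [Fin.succAbove_of_castSucc_lt _ _ (Fin.castSucc_lt_castSucc_iff.mpr h)]
    have h' : i.1 ≤ k.1 := h.le
    simp [liftVec, h']
  · rw [Fin.succAbove_of_le_castSucc _ _ (Fin.castSucc_le_castSucc_iff.mpr h)]
    have h' : ¬ i.1 + 1 ≤ k.1 := by have : k.1 ≤ i.1 := h; omega
    simp [liftVec, h']

/-- Expansion of a determinant in which one row is another row plus a standard unit vector. -/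
theorem det_eq_of_row_eq_add_single {R : Type*} [CommRing R] {N : ℕ}
    (A : Matrix (Fin (N + 1)) (Fin (N + 1)) R) {a b : Fin (N + 1)} (hab : a ≠ b)
    (p : Fin (N + 1)) (h : A a = A b + Pi.single p 1) :
    A.det = (-1) ^ ((a : ℕ) + p) * (A.submatrix a.succAbove p.succAbove).det := by
  rw [← Matrix.det_updateRow_add_smul_self A hab (-1), Matrix.det_succ_row _ a,
    Finset.sum_eq_single p]
  · rw [Matrix.submatrix_updateRow_succAbove]
    simp [h]
  · intro q _ hq
    simp [h, hq]
  · simp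

/-- **Sign change of the concatenated determinant under edge subdivision.**
Subdividing the edge `e_k` (0-based index `k`, i.e. 1-based index `k+1`) inserts a new
first vertex and splits the row `e_k` into two consecutive rows; the columns of the lifted
matrices `𝒞'` and `𝒫'` are as described, with the column of the new vertex being the lift
of the column of `𝒫` at the tail of `e_k` (zero if the tail is `v⋆`) plus the unit vector
at the first of the two new edges. The concatenated determinant changes by `(−1)^{k+1}`
(in 1-based labels, i.e. `(−1)^{(k+1)+1}` here). -/
theorem subdivision_sign (m n' ℓ : ℕ) (s t : Fin m → Fin (n' + 1))
    (hconn : IsConnectedGraph m (n' + 1) s t)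
    (hm : ℓ + n' = m) (hEven : Even ℓ)
    (C : Matrix (Fin m) (Fin ℓ) ℤ) (hC : IsCycleMatrix m n' ℓ s t C)
    (P : Matrix (Fin m) (Fin n') ℤ) (hP : Pᵀ * inc ℤ m n' s t = 1)
    (k : Fin m) :
    (concat (show ℓ + (n' + 1) = m + 1 by omega)
        (Matrix.of fun i c => liftVec k (fun e => C e c) i)
        (Matrix.of fun i j =>
          if hj : j = (0 : Fin (n' + 1)) then
            liftVec k (fun e =>
                if hv : s k = Fin.last n' then 0 else P e ((s k).castPred hv)) i +
              (if i = Fin.castSucc k then 1 else 0)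
          else liftVec k (fun e => P e (j.pred hj)) i)).det =
      (-1 : ℤ) ^ (((k : ℕ) + 1) + 1) * (concat hm C P).det := by
  subst hm
  have hcast : ℓ + (n' + 1) = ℓ + n' + 1 := by omega
  set p : Fin (ℓ + n' + 1) := Fin.cast hcast (Fin.natAdd ℓ 0) with hp
  have hleft (j : Fin ℓ) :
      p.succAbove (Fin.castAdd n' j) = Fin.cast hcast (Fin.castAdd (n' + 1) j) := by
    rw [Fin.succAbove_of_castSucc_lt _ _ (by simp [hp, Fin.lt_def])]
    rfl
  have hright (j : Fin n') :
      p.succAbove (Fin.natAdd ℓ j) = Fin.cast hcast (Fin.natAdd ℓ j.succ) := by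
    rw [Fin.succAbove_of_le_castSucc _ _ (by simp [hp, Fin.le_def])]
    rfl
  rw [det_eq_of_row_eq_add_single _ (Fin.castSucc_lt_succ (i := k)).ne p]
  · congr 1
    · simp [hp, pow_add, hEven.neg_one_pow]
    · congr 1
      ext i j
      induction j using Fin.addCases with
      | left j =>
        rw [Matrix.submatrix_apply, hleft, concat_cast_castAdd]
        rw [Matrix.of_apply, liftVec_succAbove]
        exact (concat_cast_castAdd rfl C P i j).symm
      | right j =>
        rw [Matrix.submatrix_apply, hright, concat_cast_natAdd]
        simp only [Matrix.of_apply, Fin.succ_ne_zero, dite_false, Fin.pred_succ,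
          liftVec_succAbove]
        exact (concat_cast_natAdd rfl C P i j).symm
  · ext j
    obtain ⟨j, rfl⟩ := (finCongr hcast).surjective j
    rw [finCongr_apply, Pi.add_apply]
    induction j using Fin.addCases with
    | left j =>
      have hne : Fin.cast hcast (Fin.castAdd (n' + 1) j) ≠ p := by
        simp only [hp, ne_eq, Fin.ext_iff, Fin.val_cast, Fin.val_castAdd, Fin.val_natAdd]
        omega
      rw [concat_cast_castAdd, concat_cast_castAdd, Pi.single_eq_of_ne hne]
      simp [liftVec_castSucc, liftVec_succ]
    | right j =>
      rw [concat_cast_natAdd, concat_cast_natAdd]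
      by_cases hj : j = 0
      · subst hj
        rw [← hp, Pi.single_eq_same]
        simp only [Matrix.of_apply, dite_true, liftVec_castSucc, liftVec_succ, if_true,
          if_neg (Fin.castSucc_lt_succ (i := k)).ne', add_zero]
      · have hne : Fin.cast hcast (Fin.natAdd ℓ j) ≠ p := by
          rw [hp, (Fin.cast_injective hcast).ne_iff]
          exact fun h => hj ((Fin.natAdd_inj ℓ).mp h)
        rw [Pi.single_eq_of_ne hne]
        simp [hj, liftVec_castSucc, liftVec_succ]
end GraphForms
end
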